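/- Let n, m, ι be finite types, S₀ : Matrix n m ℂ with S₀† * S₀ = 1, and let (M_μ)_{μ∈ι} be a family of matrices in Matrix n n ℂ together with scalars λ_μ ∈ ℂ such that M_μ * S₀ = λ_μ • S₀ for every μ and Σ_μ M_μ† * M_μ = 1. Then for every Hermitian matrix H₁ : Matrix n n ℂ and every ρ : Matrix m m ℂ one has Σ_μ S₀† * M_μ * (H₁ * S₀ * ρ * S₀† − S₀ * ρ * S₀† * H₁) * M_μ† * S₀ = (S₀† * H₁ * S₀) * ρ − ρ * (S₀† * H₁ * S₀). (First part of Lemma 1: for a Hamiltonian perturbation 𝓛₁(ρ) = −i[H₁,ρ], the first-order slow dynamics is 𝓛_{s,1}(ρ_s) = −i[H_{s,1}, ρ_s] with Zeno Hamiltonian H_{s,1} = S₀† H₁ S₀.) -/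

import Mathlib

open Matrix

/-- First part of Lemma 1: for a Hamiltonian perturbation `𝓛₁(ρ) = −i[H₁,ρ]`, the
first-order slow dynamics is `𝓛_{s,1}(ρ_s) = −i[H_{s,1}, ρ_s]` with Zeno Hamiltonian
`H_{s,1} = S₀† H₁ S₀`. -/
theorem zeno_hamiltonian {n m ι : Type*} [Fintype n] [Fintype m] [Fintype ι]
    [DecidableEq n] [DecidableEq m]
    (S₀ : Matrix n m ℂ) (hS₀ : S₀ᴴ * S₀ = 1)
    (M : ι → Matrix n n ℂ) (lam : ι → ℂ)
    (hMS : ∀ μ, M μ * S₀ = lam μ • S₀)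
    (hTP : ∑ μ, (M μ)ᴴ * M μ = 1)
    (H₁ : Matrix n n ℂ) (hH₁ : H₁ᴴ = H₁)
    (ρ : Matrix m m ℂ) :
    ∑ μ, S₀ᴴ * M μ * (H₁ * S₀ * ρ * S₀ᴴ - S₀ * ρ * S₀ᴴ * H₁) * (M μ)ᴴ * S₀
      = (S₀ᴴ * H₁ * S₀) * ρ - ρ * (S₀ᴴ * H₁ * S₀) := by
  have hSM : ∀ μ, S₀ᴴ * (M μ)ᴴ = star (lam μ) • S₀ᴴ := fun μ => by
    rw [← conjTranspose_mul, hMS, conjTranspose_smul]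
  have hRight : ∑ μ, lam μ • ((M μ)ᴴ * S₀) = S₀ := by
    calc ∑ μ, lam μ • ((M μ)ᴴ * S₀) = ∑ μ, (M μ)ᴴ * M μ * S₀ :=
          Finset.sum_congr rfl fun μ _ => by rw [Matrix.mul_assoc, hMS, Matrix.mul_smul]
      _ = S₀ := by rw [← Matrix.sum_mul, hTP, Matrix.one_mul]
  have hLeft : ∑ μ, star (lam μ) • (S₀ᴴ * M μ) = S₀ᴴ := by
    calc ∑ μ, star (lam μ) • (S₀ᴴ * M μ) = ∑ μ, S₀ᴴ * ((M μ)ᴴ * M μ) :=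
          Finset.sum_congr rfl fun μ _ => by rw [← Matrix.mul_assoc, hSM, Matrix.smul_mul]
      _ = S₀ᴴ := by rw [← Matrix.mul_sum, hTP, Matrix.mul_one]
  have hTerm : ∀ μ, S₀ᴴ * M μ * (H₁ * S₀ * ρ * S₀ᴴ - S₀ * ρ * S₀ᴴ * H₁) * (M μ)ᴴ * S₀
      = (star (lam μ) • (S₀ᴴ * M μ)) * (H₁ * S₀ * ρ)
        - (ρ * S₀ᴴ * H₁) * (lam μ • ((M μ)ᴴ * S₀)) := fun μ => by
    have h₁ : S₀ᴴ * M μ * (H₁ * S₀ * ρ * S₀ᴴ) * (M μ)ᴴ * S₀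
        = S₀ᴴ * M μ * (H₁ * S₀ * ρ) * (S₀ᴴ * (M μ)ᴴ) * S₀ := by
      simp only [Matrix.mul_assoc]
    have h₂ : S₀ᴴ * M μ * (S₀ * ρ * S₀ᴴ * H₁) * (M μ)ᴴ * S₀
        = S₀ᴴ * (M μ * S₀) * (ρ * S₀ᴴ * H₁) * ((M μ)ᴴ * S₀) := by
      simp only [Matrix.mul_assoc]
    rw [Matrix.mul_sub, Matrix.sub_mul, Matrix.sub_mul, h₁, h₂, hSM, hMS]
    simp only [Matrix.mul_smul, Matrix.smul_mul, hS₀, Matrix.one_mul]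
    rw [Matrix.mul_assoc _ S₀ᴴ S₀, hS₀, Matrix.mul_one]
  simp only [hTerm]
  rw [Finset.sum_sub_distrib, ← Matrix.sum_mul, ← Matrix.mul_sum, hLeft, hRight]
  simp only [Matrix.mul_assoc]
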